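/- The radical {v ∈ G : ∀ w ∈ G, ω(v,w) = 0} of the check span equals the F₂-span of the m−1 stabilizer vectors S^X_i and the n−1 stabilizer vectors S^Z_j, and these m+n−2 vectors are linearly independent. -/

import Mathlib

open Finset

/-- The F₂-vector space of Pauli operators (mod phase) on the m×n grid:
first component is the X-support, second the Z-support. -/
abbrev V (m n : ℕ) := ((Fin m × Fin n) → ZMod 2) × ((Fin m × Fin n) → ZMod 2)

/-- Symplectic form: two Paulis commute iff `omega` of their vectors is 0. -/
def omega {m n : ℕ} (v w : V m n) : ZMod 2 :=
  ∑ q : Fin m × Fin n, (v.1 q * w.2 q + w.1 q * v.2 q)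

/-- Horizontal XX check H(i,j): X-part the indicator of {(i,j),(i+1,j)}
(here i ranges over Fin (m-1), i.e. 0 ≤ i ≤ m−2). -/
def Hcheck {m n : ℕ} (i : Fin (m - 1)) (j : Fin n) : V m n :=
  (fun q => if (q.1.val = i.val ∨ q.1.val = i.val + 1) ∧ q.2 = j then 1 else 0, 0)

/-- Vertical ZZ check W(i,j): Z-part the indicator of {(i,j),(i,j+1)}
(here j ranges over Fin (n-1), i.e. 0 ≤ j ≤ n−2). -/
def Wcheck {m n : ℕ} (i : Fin m) (j : Fin (n - 1)) : V m n :=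
  (0, fun q => if q.1 = i ∧ (q.2.val = j.val ∨ q.2.val = j.val + 1) then 1 else 0)

/-- The F₂-span G of all Bacon-Shor check vectors. -/
def checkSpan (m n : ℕ) : Submodule (ZMod 2) (V m n) :=
  Submodule.span (ZMod 2)
    ((Set.range fun p : Fin (m - 1) × Fin n => Hcheck p.1 p.2) ∪
     (Set.range fun p : Fin m × Fin (n - 1) => Wcheck p.1 p.2))

/-- `omega · w` as a linear map in the first argument. -/
def omegaR {m n : ℕ} (w : V m n) : V m n →ₗ[ZMod 2] ZMod 2 where
  toFun v := omega v w
  map_add' a b := by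
    simp only [omega, Prod.fst_add, Prod.snd_add, Pi.add_apply]
    rw [← Finset.sum_add_distrib]
    exact Finset.sum_congr rfl fun q _ => by ring
  map_smul' c a := by
    simp only [omega, Prod.smul_fst, Prod.smul_snd, Pi.smul_apply, smul_eq_mul,
      RingHom.id_apply, Finset.mul_sum]
    exact Finset.sum_congr rfl fun q _ => by ring

/-- The radical {v ∈ G : ∀ w ∈ G, ω(v,w) = 0} of the symplectic form on G. -/
def radical (m n : ℕ) : Submodule (ZMod 2) (V m n) :=
  checkSpan m n ⊓ ⨅ w ∈ checkSpan m n, LinearMap.ker (omegaR w)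

/-- The centralizer {v ∈ V : ∀ w ∈ G, ω(v,w) = 0} of the check span. -/
def centralizer (m n : ℕ) : Submodule (ZMod 2) (V m n) :=
  ⨅ w ∈ checkSpan m n, LinearMap.ker (omegaR w)

/-- Vertical X-type stabilizer S^X_i (i = 1,…,m−1 encoded as Fin (m-1) via i ↦ i−1):
X-part the indicator of {i−1,i} × Fin n. -/
def SX {m n : ℕ} (i : Fin (m - 1)) : V m n :=
  (fun q => if q.1.val = i.val ∨ q.1.val = i.val + 1 then 1 else 0, 0)

/-- Horizontal Z-type stabilizer S^Z_j (j = 1,…,n−1 encoded as Fin (n-1) via j ↦ j−1):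
Z-part the indicator of Fin m × {j−1,j}. -/
def SZ {m n : ℕ} (j : Fin (n - 1)) : V m n :=
  (0, fun q => if q.2.val = j.val ∨ q.2.val = j.val + 1 then 1 else 0)

/-- Logical X̄_L: X-part the indicator of {0} × Fin n. -/
def XL {m n : ℕ} : V m n :=
  (fun q => if q.1.val = 0 then 1 else 0, 0)

/-- Logical Z̄_L: Z-part the indicator of Fin m × {0}. -/
def ZL {m n : ℕ} : V m n :=
  (0, fun q => if q.2.val = 0 then 1 else 0)

/-- Gauge qubit X̄_{a,b} (1 ≤ a ≤ m−1, 1 ≤ b ≤ n−1, encoded as Fin (m-1) × Fin (n-1)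
via (a,b) ↦ (a−1,b−1)): X-part the indicator of {a−1,a} × {b,…,n−1}. -/
def gaugeX {m n : ℕ} (a : Fin (m - 1)) (b : Fin (n - 1)) : V m n :=
  (fun q => if (q.1.val = a.val ∨ q.1.val = a.val + 1) ∧ b.val + 1 ≤ q.2.val then 1 else 0, 0)

/-- Gauge qubit Z̄_{a,b}: Z-part the indicator of {a,…,m−1} × {b−1,b}. -/
def gaugeZ {m n : ℕ} (a : Fin (m - 1)) (b : Fin (n - 1)) : V m n :=
  (0, fun q => if a.val + 1 ≤ q.1.val ∧ (q.2.val = b.val ∨ q.2.val = b.val + 1) then 1 else 0)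

/-- Destabilizer D^X_j: X-part the indicator of {0} × {j,…,n−1}. -/
def DX {m n : ℕ} (j : Fin (n - 1)) : V m n :=
  (fun q => if q.1.val = 0 ∧ j.val + 1 ≤ q.2.val then 1 else 0, 0)

/-- Destabilizer D^Z_i: Z-part the indicator of {i,…,m−1} × {0}. -/
def DZ {m n : ℕ} (i : Fin (m - 1)) : V m n :=
  (0, fun q => if i.val + 1 ≤ q.1.val ∧ q.2.val = 0 then 1 else 0)

/-- The indicator of `{i, i + 1}` in `Fin k`. -/
def pairInd {k : ℕ} (i : Fin (k - 1)) : Fin k → ZMod 2 :=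
  fun x => if x.val = i.val ∨ x.val = i.val + 1 then 1 else 0

lemma sum_mul_pairInd {k : ℕ} (g : Fin k → ZMod 2) (i : Fin (k - 1)) :
    ∑ x, g x * pairInd i x = g ⟨i, by omega⟩ + g ⟨i + 1, by omega⟩ := by
  have h : ∀ x : Fin k, g x * pairInd i x =
      (if x = ⟨i, by omega⟩ then g x else 0) + (if x = ⟨i + 1, by omega⟩ then g x else 0) := by
    intro x
    simp only [pairInd, Fin.ext_iff]
    by_cases h1 : x.val = i.val
    · simp [h1]
    · simp [h1]
  simp [h, sum_add_distrib]

lemma sum_pairInd {k : ℕ} (i : Fin (k - 1)) : ∑ x, pairInd i x = 0 := by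
  simpa [CharTwo.add_self_eq_zero] using sum_mul_pairInd (fun _ => 1) i

lemma linearIndependent_pairInd (k : ℕ) :
    LinearIndependent (ZMod 2) (pairInd (k := k)) := by
  rw [Fintype.linearIndependent_iff]
  intro c hc j
  have h : ∑ x : Fin k, (if x.val ≤ j.val then 1 else 0) * (∑ i, c i • pairInd i) x = 0 := by
    rw [hc]
    simp
  simp only [Finset.sum_apply, Pi.smul_apply, smul_eq_mul, mul_sum] at h
  rw [sum_comm] at h
  simp only [mul_left_comm _ (c _), ← mul_sum, sum_mul_pairInd] at h
  rw [sum_eq_single j] at h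
  · simpa using h
  · intro i _ hij
    have hij' : i.val ≠ j.val := fun e => hij (Fin.ext e)
    by_cases hlt : i.val < j.val
    · simp [hlt.le, Nat.succ_le_of_lt hlt, CharTwo.add_self_eq_zero]
    · rw [if_neg (by omega), if_neg (by simp; omega)]
      simp
  · simp

lemma mem_span_pairInd {k : ℕ} (f : Fin k → ZMod 2) (hf : ∑ x, f x = 0) :
    f ∈ Submodule.span (ZMod 2) (Set.range (pairInd (k := k))) := by
  rcases Nat.eq_zero_or_pos k with rfl | hk
  · rw [Subsingleton.elim f 0]
    exact zero_mem _
  have key : ∀ (x : ℕ) (hx : x < k),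
      (Pi.single ⟨x, hx⟩ 1 + Pi.single ⟨0, hk⟩ 1 : Fin k → ZMod 2) ∈
        Submodule.span (ZMod 2) (Set.range (pairInd (k := k))) := by
    intro x
    induction x with
    | zero =>
      intro hx
      rw [show (Pi.single ⟨0, hx⟩ 1 + Pi.single ⟨0, hk⟩ 1 : Fin k → ZMod 2) = 0 from
        funext fun _ => CharTwo.add_self_eq_zero _]
      exact zero_mem _
    | succ x ih =>
      intro hx
      have h1 : (Pi.single ⟨x + 1, hx⟩ 1 + Pi.single ⟨0, hk⟩ 1 : Fin k → ZMod 2) =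
          pairInd ⟨x, by omega⟩ + (Pi.single ⟨x, by omega⟩ 1 + Pi.single ⟨0, hk⟩ 1) := by
        rw [← add_assoc]
        congr 1
        ext y
        by_cases h : y.val = x
        · simp [pairInd, Pi.single_apply, Fin.ext_iff, h, CharTwo.add_self_eq_zero]
        · simp [pairInd, Pi.single_apply, Fin.ext_iff, h]
      rw [h1]
      exact add_mem (Submodule.subset_span ⟨_, rfl⟩) (ih _)
  have h2 : f = ∑ x, f x • (Pi.single x 1 + Pi.single ⟨0, hk⟩ 1 : Fin k → ZMod 2) := by
    simp only [smul_add, sum_add_distrib, ← sum_smul, hf, zero_smul, add_zero]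
    exact pi_eq_sum_univ' f
  rw [h2]
  exact Submodule.sum_mem _ fun x _ => Submodule.smul_mem _ _ (key x x.2)

lemma eq_of_forall_add_succ_eq_zero {k : ℕ} (g : Fin k → ZMod 2)
    (hg : ∀ i : Fin (k - 1), g ⟨i, by omega⟩ + g ⟨i + 1, by omega⟩ = 0) (hk : 0 < k)
    (x : Fin k) : g x = g ⟨0, hk⟩ := by
  obtain ⟨x, hx⟩ := x
  induction x with
  | zero => rfl
  | succ x ih =>
    rw [← ih (by omega)]
    exact (CharTwo.add_eq_zero.mp (hg ⟨x, by omega⟩)).symm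

/-- The `X`-type Pauli operator supported on whole rows. -/
def rowX (m n : ℕ) : (Fin m → ZMod 2) →ₗ[ZMod 2] V m n :=
  LinearMap.inl _ _ _ ∘ₗ LinearMap.funLeft _ _ Prod.fst

/-- The `Z`-type Pauli operator supported on whole columns. -/
def colZ (m n : ℕ) : (Fin n → ZMod 2) →ₗ[ZMod 2] V m n :=
  LinearMap.inr _ _ _ ∘ₗ LinearMap.funLeft _ _ Prod.snd

lemma SX_eq {m n : ℕ} : (SX : Fin (m - 1) → V m n) = rowX m n ∘ pairInd := rfl

lemma SZ_eq {m n : ℕ} : (SZ : Fin (n - 1) → V m n) = colZ m n ∘ pairInd := rfl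

lemma linearIndependent_SX_SZ {m n : ℕ} (hm : 0 < m) (hn : 0 < n) :
    LinearIndependent (ZMod 2) (Sum.elim (SX (m := m) (n := n)) (SZ (m := m) (n := n))) := by
  have : Nonempty (Fin m) := ⟨⟨0, hm⟩⟩
  have : Nonempty (Fin n) := ⟨⟨0, hn⟩⟩
  have h1 := (linearIndependent_pairInd m).map_injOn
    (LinearMap.funLeft (ZMod 2) (ZMod 2) (Prod.fst : Fin m × Fin n → Fin m))
    (LinearMap.funLeft_injective_of_surjective _ _ _ Prod.fst_surjective).injOn
  have h2 := (linearIndependent_pairInd n).map_injOn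
    (LinearMap.funLeft (ZMod 2) (ZMod 2) (Prod.snd : Fin m × Fin n → Fin n))
    (LinearMap.funLeft_injective_of_surjective _ _ _ Prod.snd_surjective).injOn
  exact linearIndependent_inl_union_inr' h1 h2

lemma omega_Hcheck {m n : ℕ} (v : V m n) (i : Fin (m - 1)) (j : Fin n) :
    omega v (Hcheck i j) = v.2 (⟨i, by omega⟩, j) + v.2 (⟨i + 1, by omega⟩, j) := by
  rw [← sum_mul_pairInd (fun x => v.2 (x, j)) i]
  simp only [omega, Hcheck, Fintype.sum_prod_type, Pi.zero_apply, mul_zero, zero_add]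
  refine sum_congr rfl fun x _ => ?_
  rw [sum_eq_single j]
  · simp [pairInd]
  · intro b _ hb
    simp [hb]
  · simp

lemma omega_Wcheck {m n : ℕ} (v : V m n) (i : Fin m) (j : Fin (n - 1)) :
    omega v (Wcheck i j) = v.1 (i, ⟨j, by omega⟩) + v.1 (i, ⟨j + 1, by omega⟩) := by
  rw [← sum_mul_pairInd (fun y => v.1 (i, y)) j]
  simp only [omega, Wcheck, Fintype.sum_prod_type, Pi.zero_apply, zero_mul, add_zero]
  rw [sum_eq_single i]
  · simp [pairInd]
  · intro b _ hb
    simp [hb]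
  · simp

lemma omega_comm {m n : ℕ} (v w : V m n) : omega v w = omega w v :=
  sum_congr rfl fun _ _ => add_comm _ _

lemma mem_centralizer_iff {m n : ℕ} (v : V m n) :
    v ∈ centralizer m n ↔
      (∀ i j, omega v (Hcheck i j) = 0) ∧ ∀ i j, omega v (Wcheck i j) = 0 := by
  have h : v ∈ centralizer m n ↔ checkSpan m n ≤ LinearMap.ker (omegaR v) := by
    simp only [centralizer, Submodule.mem_iInf, SetLike.le_def, LinearMap.mem_ker]
    exact forall₂_congr fun w _ => by
      change omega v w = 0 ↔ omega w v = 0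
      rw [omega_comm]
  rw [h, checkSpan, Submodule.span_le, Set.union_subset_iff, Set.range_subset_iff,
    Set.range_subset_iff, Prod.forall, Prod.forall]
  simp only [SetLike.mem_coe, LinearMap.mem_ker, omega_comm v]
  rfl

/-- Elements of the check span have even `X`-weight in each column and even `Z`-weight in each
row. -/
lemma sum_eq_zero_of_mem_checkSpan {m n : ℕ} {v : V m n} (hv : v ∈ checkSpan m n) :
    (∀ j, ∑ i, v.1 (i, j) = 0) ∧ ∀ i, ∑ j, v.2 (i, j) = 0 := by
  induction hv using Submodule.span_induction with
  | mem v hv =>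
    rcases hv with ⟨⟨i, j⟩, rfl⟩ | ⟨⟨i, j⟩, rfl⟩
    · refine ⟨fun y => ?_, by simp [Hcheck]⟩
      by_cases hy : y = j
      · simpa [Hcheck, hy, pairInd] using sum_pairInd i
      · simp [Hcheck, hy]
    · refine ⟨by simp [Wcheck], fun x => ?_⟩
      by_cases hx : x = i
      · simpa [Wcheck, hx, pairInd] using sum_pairInd j
      · simp [Wcheck, hx]
  | zero => simp
  | add v w _ _ hv hw => simp [sum_add_distrib, hv, hw]
  | smul c v _ hv => simp [← mul_sum, hv]

lemma SX_mem_radical {m n : ℕ} (i : Fin (m - 1)) : (SX i : V m n) ∈ radical m n := by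
  refine Submodule.mem_inf.mpr ⟨?_, (mem_centralizer_iff _).mpr ⟨fun a b => ?_, fun a b => ?_⟩⟩
  · have h : (SX i : V m n) = ∑ j, Hcheck i j := by
      ext q
      · by_cases hq : q.1.val = i.val ∨ q.1.val = i.val + 1 <;>
          simp [SX, Hcheck, Prod.fst_sum, hq]
      · simp [SX, Hcheck, Prod.snd_sum]
    rw [h]
    exact Submodule.sum_mem _ fun j _ => Submodule.subset_span (Or.inl ⟨(i, j), rfl⟩)
  · simp [omega_Hcheck, SX]
  · simp [omega_Wcheck, SX, CharTwo.add_self_eq_zero]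

lemma SZ_mem_radical {m n : ℕ} (j : Fin (n - 1)) : (SZ j : V m n) ∈ radical m n := by
  refine Submodule.mem_inf.mpr ⟨?_, (mem_centralizer_iff _).mpr ⟨fun a b => ?_, fun a b => ?_⟩⟩
  · have h : (SZ j : V m n) = ∑ i, Wcheck i j := by
      ext q
      · simp [SZ, Wcheck, Prod.fst_sum]
      · by_cases hq : q.2.val = j.val ∨ q.2.val = j.val + 1 <;>
          simp [SZ, Wcheck, Prod.snd_sum, hq]
    rw [h]
    exact Submodule.sum_mem _ fun i _ => Submodule.subset_span (Or.inr ⟨(i, j), rfl⟩)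
  · simp [omega_Hcheck, SZ, CharTwo.add_self_eq_zero]
  · simp [omega_Wcheck, SZ]

lemma radical_le_span {m n : ℕ} (hm : 0 < m) (hn : 0 < n) :
    radical m n ≤ Submodule.span (ZMod 2)
      (Set.range (SX (m := m) (n := n)) ∪ Set.range (SZ (m := m) (n := n))) := by
  intro v hv
  obtain ⟨hspan, hcent⟩ := Submodule.mem_inf.mp hv
  obtain ⟨hH, hW⟩ := (mem_centralizer_iff v).mp hcent
  obtain ⟨hcol, hrow⟩ := sum_eq_zero_of_mem_checkSpan hspan
  have h1 : ∀ i j, v.1 (i, j) = v.1 (i, ⟨0, hn⟩) := fun i j =>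
    eq_of_forall_add_succ_eq_zero (fun y => v.1 (i, y))
      (fun b => (omega_Wcheck v i b).symm.trans (hW i b)) hn j
  have h2 : ∀ i j, v.2 (i, j) = v.2 (⟨0, hm⟩, j) := fun i j =>
    eq_of_forall_add_succ_eq_zero (fun x => v.2 (x, j))
      (fun a => (omega_Hcheck v a j).symm.trans (hH a j)) hm i
  have hdecomp : v = rowX m n (fun i => v.1 (i, ⟨0, hn⟩)) +
      colZ m n (fun j => v.2 (⟨0, hm⟩, j)) := by
    ext q
    · simp [rowX, colZ, LinearMap.funLeft_apply, ← h1 q.1 q.2]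
    · simp [rowX, colZ, LinearMap.funLeft_apply, ← h2 q.1 q.2]
  rw [hdecomp, Submodule.span_union, SX_eq, SZ_eq, Set.range_comp, Set.range_comp,
    ← Submodule.map_span, ← Submodule.map_span]
  exact Submodule.add_mem_sup
    (Submodule.mem_map_of_mem (mem_span_pairInd _ (hcol _)))
    (Submodule.mem_map_of_mem (mem_span_pairInd _ (hrow _)))

/-- The radical of the check span equals the F₂-span of the stabilizer vectors
S^X_i and S^Z_j, and these m+n−2 vectors are linearly independent. -/
theorem stmt3 (m n : ℕ) (hm : 2 ≤ m) (hn : 2 ≤ n) :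
    radical m n = Submodule.span (ZMod 2)
      (Set.range (SX (m := m) (n := n)) ∪ Set.range (SZ (m := m) (n := n))) ∧
    LinearIndependent (ZMod 2) (Sum.elim (SX (m := m) (n := n)) (SZ (m := m) (n := n))) := by
  refine ⟨le_antisymm (radical_le_span (by omega) (by omega)) ?_,
    linearIndependent_SX_SZ (by omega) (by omega)⟩
  rw [Submodule.span_le, Set.union_subset_iff, Set.range_subset_iff, Set.range_subset_iff]
  exact ⟨SX_mem_radical, SZ_mem_radical⟩
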